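/- DAMI(2,2)(4) is a dual-affine invariant of 2D vector fields: with central moments u_{pqrs} of the object (Ω, f) and u*_{pqrs} of the transformed object (Ω*, f*) under any unimodular dual-affine transformation (A_M, A_N ∈ SL(2,ℝ), translations b, c ∈ ℝ²), the expression u_{0201}²·u_{2010}² − 2·u_{0201}·u_{0210}·u_{2001}·u_{2010} − 4·u_{0201}·u_{1101}·u_{1110}·u_{2010} + 4·u_{0201}·u_{1110}²·u_{2001} + u_{0210}²·u_{2001}² + 4·u_{0210}·u_{1101}²·u_{2010} − 4·u_{0210}·u_{1101}·u_{1110}·u_{2001} takes the same value when computed from u*_{pqrs} as when computed from u_{pqrs}. -/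

import Mathlib

open MeasureTheory

/-- Centroid `(x̄, ȳ) = V⁻¹ ∫_Ω (x,y) dxdy` of a bounded set `Ω ⊂ ℝ²`. -/
noncomputable def centroid2 (Ω : Set (Fin 2 → ℝ)) : Fin 2 → ℝ :=
  (volume Ω).toReal⁻¹ • ∫ x in Ω, x

/-- Mean `(f̄₁, f̄₂) = V⁻¹ ∫_Ω f dxdy` of a 2D vector field over `Ω`. -/
noncomputable def meanField2 (Ω : Set (Fin 2 → ℝ))
    (f : (Fin 2 → ℝ) → (Fin 2 → ℝ)) : Fin 2 → ℝ :=
  (volume Ω).toReal⁻¹ • ∫ x in Ω, f x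

/-- Central moment
`u_{pqrs} = ∫_Ω (x − x̄)^p (y − ȳ)^q (f₁ − f̄₁)^r (f₂ − f̄₂)^s dxdy`. -/
noncomputable def u (Ω : Set (Fin 2 → ℝ)) (f : (Fin 2 → ℝ) → (Fin 2 → ℝ))
    (p q r s : ℕ) : ℝ :=
  ∫ x in Ω, (x 0 - centroid2 Ω 0) ^ p * (x 1 - centroid2 Ω 1) ^ q *
    (f x 0 - meanField2 Ω f 0) ^ r * (f x 1 - meanField2 Ω f 1) ^ s

/-- The transformed domain `Ω* = {A_M x + b : x ∈ Ω}`. -/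
def domStar (A_M : Matrix.SpecialLinearGroup (Fin 2) ℝ) (b : Fin 2 → ℝ)
    (Ω : Set (Fin 2 → ℝ)) : Set (Fin 2 → ℝ) :=
  (fun x => (A_M : Matrix (Fin 2) (Fin 2) ℝ).mulVec x + b) '' Ω

/-- The transformed vector field `f*(x) = A_N·f(A_M⁻¹(x − b)) + c`. -/
noncomputable def fieldStar (A_M A_N : Matrix.SpecialLinearGroup (Fin 2) ℝ)
    (b c : Fin 2 → ℝ) (f : (Fin 2 → ℝ) → (Fin 2 → ℝ)) :
    (Fin 2 → ℝ) → (Fin 2 → ℝ) :=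
  fun x => (A_N : Matrix (Fin 2) (Fin 2) ℝ).mulVec
      (f ((A_M⁻¹ : Matrix.SpecialLinearGroup (Fin 2) ℝ).1.mulVec (x - b))) + c

/-- The resultant of the binary quadratic forms
`a₁ x² + 2 b₁ x y + c₁ y²` and `a₂ x² + 2 b₂ x y + c₂ y²`. -/
def quadResultant (a₁ b₁ c₁ a₂ b₂ c₂ : ℝ) : ℝ :=
  (a₁ * c₂ - a₂ * c₁) ^ 2 - 4 * (a₁ * b₂ - a₂ * b₁) * (b₁ * c₂ - b₂ * c₁)

theorem quadResultant_pencil (a₁ b₁ c₁ a₂ b₂ c₂ p q r s : ℝ) :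
    quadResultant (p * a₁ + q * a₂) (p * b₁ + q * b₂) (p * c₁ + q * c₂)
      (r * a₁ + s * a₂) (r * b₁ + s * b₂) (r * c₁ + s * c₂) =
    (p * s - q * r) ^ 2 * quadResultant a₁ b₁ c₁ a₂ b₂ c₂ := by
  unfold quadResultant
  ring

theorem quadResultant_substitution (a₁ b₁ c₁ a₂ b₂ c₂ p q r s : ℝ) :
    quadResultant
      (p ^ 2 * a₁ + 2 * p * q * b₁ + q ^ 2 * c₁)
      (p * r * a₁ + (p * s + q * r) * b₁ + q * s * c₁)
      (r ^ 2 * a₁ + 2 * r * s * b₁ + s ^ 2 * c₁)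
      (p ^ 2 * a₂ + 2 * p * q * b₂ + q ^ 2 * c₂)
      (p * r * a₂ + (p * s + q * r) * b₂ + q * s * c₂)
      (r ^ 2 * a₂ + 2 * r * s * b₂ + s ^ 2 * c₂) =
    (p * s - q * r) ^ 4 * quadResultant a₁ b₁ c₁ a₂ b₂ c₂ := by
  unfold quadResultant
  ring

theorem inv_mulVec_mulVec (A : Matrix.SpecialLinearGroup (Fin 2) ℝ) (x : Fin 2 → ℝ) :
    (A⁻¹).1.mulVec (A.1.mulVec x) = x := by
  have h : (A⁻¹).1 * A.1 = 1 := congrArg Subtype.val (inv_mul_cancel A)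
  rw [Matrix.mulVec_mulVec, h, Matrix.one_mulVec]

theorem setIntegral_domStar {E : Type*} [NormedAddCommGroup E] [NormedSpace ℝ E]
    {Ω : Set (Fin 2 → ℝ)} (hΩ : MeasurableSet Ω)
    (A : Matrix.SpecialLinearGroup (Fin 2) ℝ) (b : Fin 2 → ℝ) (g : (Fin 2 → ℝ) → E) :
    ∫ x in domStar A b Ω, g x = ∫ x in Ω, g (A.1.mulVec x + b) := by
  have hder : ∀ x ∈ Ω, HasFDerivWithinAt (fun x => A.1.mulVec x + b)
      (LinearMap.toContinuousLinearMap (Matrix.toLin' A.1)) Ω x := fun x _ =>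
    ((LinearMap.toContinuousLinearMap (Matrix.toLin' A.1)).hasFDerivWithinAt).add_const b
  have hinj : Set.InjOn (fun x => A.1.mulVec x + b) Ω := by
    intro x _ y _ hxy
    have h := congrArg (A⁻¹).1.mulVec (add_right_cancel hxy)
    rwa [inv_mulVec_mulVec, inv_mulVec_mulVec] at h
  have h := integral_image_eq_integral_abs_det_fderiv_smul volume hΩ hder hinj g
  simpa [domStar, LinearMap.det_toContinuousLinearMap, LinearMap.det_toLin'] using h

theorem toReal_volume_domStar {Ω : Set (Fin 2 → ℝ)} (hΩ : MeasurableSet Ω)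
    (A : Matrix.SpecialLinearGroup (Fin 2) ℝ) (b : Fin 2 → ℝ) :
    (volume (domStar A b Ω)).toReal = (volume Ω).toReal := by
  simpa [Measure.real] using setIntegral_domStar hΩ A b (fun _ => (1 : ℝ))

theorem meanField2_mulVec_add {Ω : Set (Fin 2 → ℝ)} (hV : 0 < (volume Ω).toReal)
    {f : (Fin 2 → ℝ) → (Fin 2 → ℝ)} (hf : IntegrableOn f Ω)
    (A : Matrix (Fin 2) (Fin 2) ℝ) (c : Fin 2 → ℝ) :
    meanField2 Ω (fun x => A.mulVec (f x) + c) = A.mulVec (meanField2 Ω f) + c := by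
  have hlt : volume Ω < ⊤ := by
    by_contra h
    simp [not_lt_top_iff.mp h] at hV
  let L := LinearMap.toContinuousLinearMap (Matrix.toLin' A)
  have hL : ∀ y, L y = A.mulVec y := fun y => rfl
  have h : ∫ x in Ω, (A.mulVec (f x) + c) =
      A.mulVec (∫ x in Ω, f x) + (volume Ω).toReal • c := by
    simp_rw [← hL]
    rw [integral_add (L.integrable_comp hf) (integrableOn_const hlt.ne),
      L.integral_comp_comm hf, setIntegral_const, Measure.real]
  unfold meanField2
  rw [h, smul_add, smul_smul, inv_mul_cancel₀ hV.ne', one_smul, Matrix.mulVec_smul]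

theorem fieldStar_apply (A_M A_N : Matrix.SpecialLinearGroup (Fin 2) ℝ)
    (b c : Fin 2 → ℝ) (f : (Fin 2 → ℝ) → (Fin 2 → ℝ)) (x : Fin 2 → ℝ) :
    fieldStar A_M A_N b c f (A_M.1.mulVec x + b) = A_N.1.mulVec (f x) + c := by
  rw [fieldStar, add_sub_cancel_right, inv_mulVec_mulVec]

theorem integrableOn_id_of_isBounded {Ω : Set (Fin 2 → ℝ)}
    (hΩm : MeasurableSet Ω) (hΩb : Bornology.IsBounded Ω) :
    IntegrableOn (fun x : Fin 2 → ℝ => x) Ω := by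
  obtain ⟨R, hR⟩ := hΩb.exists_norm_le
  exact Measure.integrableOn_of_bounded hΩb.measure_lt_top.ne
    measurable_id.aestronglyMeasurable ((ae_restrict_iff' hΩm).2 (.of_forall hR))

theorem integrableOn_of_bounded_field {Ω : Set (Fin 2 → ℝ)} (hΩb : Bornology.IsBounded Ω)
    {f : (Fin 2 → ℝ) → (Fin 2 → ℝ)} (hfm : Measurable f) (hfb : ∃ C : ℝ, ∀ x, ‖f x‖ ≤ C) :
    IntegrableOn f Ω := by
  obtain ⟨C, hC⟩ := hfb
  exact Measure.integrableOn_of_bounded hΩb.measure_lt_top.ne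
    hfm.aestronglyMeasurable (.of_forall hC)

theorem u_domStar_fieldStar {Ω : Set (Fin 2 → ℝ)}
    (hΩm : MeasurableSet Ω) (hΩb : Bornology.IsBounded Ω) (hV : 0 < (volume Ω).toReal)
    {f : (Fin 2 → ℝ) → (Fin 2 → ℝ)} (hfm : Measurable f) (hfb : ∃ C : ℝ, ∀ x, ‖f x‖ ≤ C)
    (A_M A_N : Matrix.SpecialLinearGroup (Fin 2) ℝ) (b c : Fin 2 → ℝ) (p q r s : ℕ) :
    u (domStar A_M b Ω) (fieldStar A_M A_N b c f) p q r s =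
      ∫ x in Ω, A_M.1.mulVec (x - centroid2 Ω) 0 ^ p * A_M.1.mulVec (x - centroid2 Ω) 1 ^ q *
        A_N.1.mulVec (f x - meanField2 Ω f) 0 ^ r *
        A_N.1.mulVec (f x - meanField2 Ω f) 1 ^ s := by
  have hc : centroid2 (domStar A_M b Ω) = A_M.1.mulVec (centroid2 Ω) + b := by
    rw [← show meanField2 Ω (fun x => x) = centroid2 Ω from rfl,
      ← meanField2_mulVec_add hV (integrableOn_id_of_isBounded hΩm hΩb)]
    rw [centroid2, meanField2, toReal_volume_domStar hΩm, setIntegral_domStar hΩm]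
  have hm : meanField2 (domStar A_M b Ω) (fieldStar A_M A_N b c f) =
      A_N.1.mulVec (meanField2 Ω f) + c := by
    rw [← meanField2_mulVec_add hV (integrableOn_of_bounded_field hΩb hfm hfb)]
    rw [meanField2, meanField2, toReal_volume_domStar hΩm, setIntegral_domStar hΩm]
    simp_rw [fieldStar_apply]
  rw [u, setIntegral_domStar hΩm, hc, hm]
  simp only [fieldStar_apply, Matrix.mulVec_sub, Pi.add_apply, Pi.sub_apply,
    add_sub_add_right_eq_sub]

theorem integrableOn_centralMoment {Ω : Set (Fin 2 → ℝ)}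
    (hΩm : MeasurableSet Ω) (hΩb : Bornology.IsBounded Ω)
    {f : (Fin 2 → ℝ) → (Fin 2 → ℝ)} (hfm : Measurable f) (hfb : ∃ C : ℝ, ∀ x, ‖f x‖ ≤ C)
    (p q r s : ℕ) :
    IntegrableOn (fun x => (x 0 - centroid2 Ω 0) ^ p * (x 1 - centroid2 Ω 1) ^ q *
      (f x 0 - meanField2 Ω f 0) ^ r * (f x 1 - meanField2 Ω f 1) ^ s) Ω := by
  obtain ⟨C, hC⟩ := hfb
  obtain ⟨R, hR⟩ := hΩb.exists_norm_le
  have hx : ∀ x ∈ Ω, ∀ i, |x i - centroid2 Ω i| ≤ R + ‖centroid2 Ω‖ := fun x hx i =>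
    (norm_le_pi_norm (x - centroid2 Ω) i).trans
      ((norm_sub_le _ _).trans (by gcongr; exact hR x hx))
  have hf : ∀ x i, |f x i - meanField2 Ω f i| ≤ C + ‖meanField2 Ω f‖ := fun x i =>
    (norm_le_pi_norm (f x - meanField2 Ω f) i).trans
      ((norm_sub_le _ _).trans (by gcongr; exact hC x))
  refine Measure.integrableOn_of_bounded (M := (R + ‖centroid2 Ω‖) ^ p *
      (R + ‖centroid2 Ω‖) ^ q * (C + ‖meanField2 Ω f‖) ^ r * (C + ‖meanField2 Ω f‖) ^ s)
    hΩb.measure_lt_top.ne ?_ ((ae_restrict_iff' hΩm).2 (.of_forall fun x hxΩ => ?_))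
  · exact Measurable.aestronglyMeasurable (by fun_prop)
  · have h₀ := (abs_nonneg _).trans (hx x hxΩ 0)
    have h₁ := (abs_nonneg _).trans (hf x 0)
    rw [Real.norm_eq_abs]
    simp only [abs_mul, abs_pow]
    gcongr
    exacts [hx x hxΩ 0, hx x hxΩ 1, hf x 0, hf x 1]

theorem integral_quadratic_mul_linear {Ω : Set (Fin 2 → ℝ)}
    (hΩm : MeasurableSet Ω) (hΩb : Bornology.IsBounded Ω)
    {f : (Fin 2 → ℝ) → (Fin 2 → ℝ)} (hfm : Measurable f) (hfb : ∃ C : ℝ, ∀ x, ‖f x‖ ≤ C)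
    (α β γ ε φ : ℝ) :
    ∫ x in Ω, (α * (x 0 - centroid2 Ω 0) ^ 2 +
        β * ((x 0 - centroid2 Ω 0) * (x 1 - centroid2 Ω 1)) +
        γ * (x 1 - centroid2 Ω 1) ^ 2) *
      (ε * (f x 0 - meanField2 Ω f 0) + φ * (f x 1 - meanField2 Ω f 1)) =
    ε * (α * u Ω f 2 0 1 0 + β * u Ω f 1 1 1 0 + γ * u Ω f 0 2 1 0) +
    φ * (α * u Ω f 2 0 0 1 + β * u Ω f 1 1 0 1 + γ * u Ω f 0 2 0 1) := by
  have hi := fun p q r s k =>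
    (integrableOn_centralMoment hΩm hΩb hfm hfb p q r s).const_mul k
  have hg := ((hi 2 0 1 0 (ε * α)).add (hi 1 1 1 0 (ε * β))).add (hi 0 2 1 0 (ε * γ))
  have hh := ((hi 2 0 0 1 (φ * α)).add (hi 1 1 0 1 (φ * β))).add (hi 0 2 0 1 (φ * γ))
  have h := integral_add hg hh
  rw [integral_add' ((hi 2 0 1 0 (ε * α)).add (hi 1 1 1 0 (ε * β))) (hi 0 2 1 0 (ε * γ)),
    integral_add' (hi 2 0 1 0 (ε * α)) (hi 1 1 1 0 (ε * β)),
    integral_add' ((hi 2 0 0 1 (φ * α)).add (hi 1 1 0 1 (φ * β))) (hi 0 2 0 1 (φ * γ)),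
    integral_add' (hi 2 0 0 1 (φ * α)) (hi 1 1 0 1 (φ * β))] at h
  simp only [integral_const_mul] at h
  unfold u
  refine Eq.trans ?_ (h.trans (by ring))
  congr 1 with x
  simp only [Pi.add_apply]
  ring

/-- DAMI(2,2)(four) is a dual-affine invariant of 2D vector fields
under any unimodular dual-affine transformation. -/
theorem dami22_four (Ω : Set (Fin 2 → ℝ))
    (hΩm : MeasurableSet Ω) (hΩb : Bornology.IsBounded Ω)
    (hV : 0 < (volume Ω).toReal)
    (f : (Fin 2 → ℝ) → (Fin 2 → ℝ)) (hfm : Measurable f)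
    (hfb : ∃ C : ℝ, ∀ x, ‖f x‖ ≤ C)
    (A_M A_N : Matrix.SpecialLinearGroup (Fin 2) ℝ) (b c : Fin 2 → ℝ) :
    (let v := u (domStar A_M b Ω) (fieldStar A_M A_N b c f);
      v 0 2 0 1 ^ 2 * v 2 0 1 0 ^ 2 -
        2 * v 0 2 0 1 * v 0 2 1 0 * v 2 0 0 1 * v 2 0 1 0 -
        4 * v 0 2 0 1 * v 1 1 0 1 * v 1 1 1 0 * v 2 0 1 0 +
        4 * v 0 2 0 1 * v 1 1 1 0 ^ 2 * v 2 0 0 1 +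
        v 0 2 1 0 ^ 2 * v 2 0 0 1 ^ 2 +
        4 * v 0 2 1 0 * v 1 1 0 1 ^ 2 * v 2 0 1 0 -
        4 * v 0 2 1 0 * v 1 1 0 1 * v 1 1 1 0 * v 2 0 0 1)
      =
    (let v := u Ω f;
      v 0 2 0 1 ^ 2 * v 2 0 1 0 ^ 2 -
        2 * v 0 2 0 1 * v 0 2 1 0 * v 2 0 0 1 * v 2 0 1 0 -
        4 * v 0 2 0 1 * v 1 1 0 1 * v 1 1 1 0 * v 2 0 1 0 +
        4 * v 0 2 0 1 * v 1 1 1 0 ^ 2 * v 2 0 0 1 +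
        v 0 2 1 0 ^ 2 * v 2 0 0 1 ^ 2 +
        4 * v 0 2 1 0 * v 1 1 0 1 ^ 2 * v 2 0 1 0 -
        4 * v 0 2 1 0 * v 1 1 0 1 * v 1 1 1 0 * v 2 0 0 1) := by
  have hM := A_M.2
  have hN := A_N.2
  rw [Matrix.det_fin_two] at hM hN
  have key : ∀ i j k : Fin 2, ∫ x in Ω,
      A_M.1.mulVec (x - centroid2 Ω) i * A_M.1.mulVec (x - centroid2 Ω) j *
        A_N.1.mulVec (f x - meanField2 Ω f) k =
      A_N.1 k 0 * (A_M.1 i 0 * A_M.1 j 0 * u Ω f 2 0 1 0 +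
        (A_M.1 i 0 * A_M.1 j 1 + A_M.1 i 1 * A_M.1 j 0) * u Ω f 1 1 1 0 +
        A_M.1 i 1 * A_M.1 j 1 * u Ω f 0 2 1 0) +
      A_N.1 k 1 * (A_M.1 i 0 * A_M.1 j 0 * u Ω f 2 0 0 1 +
        (A_M.1 i 0 * A_M.1 j 1 + A_M.1 i 1 * A_M.1 j 0) * u Ω f 1 1 0 1 +
        A_M.1 i 1 * A_M.1 j 1 * u Ω f 0 2 0 1) := by
    intro i j k
    rw [← integral_quadratic_mul_linear hΩm hΩb hfm hfb]
    congr 1 with x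
    simp only [Matrix.mulVec, dotProduct, Fin.sum_univ_two, Pi.sub_apply]
    ring
  have expand : ∀ v : ℕ → ℕ → ℕ → ℕ → ℝ, v 0 2 0 1 ^ 2 * v 2 0 1 0 ^ 2 -
        2 * v 0 2 0 1 * v 0 2 1 0 * v 2 0 0 1 * v 2 0 1 0 -
        4 * v 0 2 0 1 * v 1 1 0 1 * v 1 1 1 0 * v 2 0 1 0 +
        4 * v 0 2 0 1 * v 1 1 1 0 ^ 2 * v 2 0 0 1 +
        v 0 2 1 0 ^ 2 * v 2 0 0 1 ^ 2 +
        4 * v 0 2 1 0 * v 1 1 0 1 ^ 2 * v 2 0 1 0 -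
        4 * v 0 2 1 0 * v 1 1 0 1 * v 1 1 1 0 * v 2 0 0 1 =
      quadResultant (v 2 0 1 0) (v 1 1 1 0) (v 0 2 1 0)
        (v 2 0 0 1) (v 1 1 0 1) (v 0 2 0 1) := by
    intro v
    unfold quadResultant
    ring
  have hsub := quadResultant_substitution (u Ω f 2 0 1 0) (u Ω f 1 1 1 0) (u Ω f 0 2 1 0)
    (u Ω f 2 0 0 1) (u Ω f 1 1 0 1) (u Ω f 0 2 0 1)
    (A_M.1 0 0) (A_M.1 0 1) (A_M.1 1 0) (A_M.1 1 1)
  rw [hM, one_pow, one_mul] at hsub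
  simp only [expand]
  rw [← hsub]
  refine Eq.trans ?_ ((quadResultant_pencil _ _ _ _ _ _
    (A_N.1 0 0) (A_N.1 0 1) (A_N.1 1 0) (A_N.1 1 1)).trans (by rw [hN, one_pow, one_mul]))
  simp only [u_domStar_fieldStar hΩm hΩb hV hfm hfb, pow_zero, pow_one, one_mul, mul_one,
    pow_two, key]
  congr 1 <;> ring
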